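/- Let A = [A_ij], B = [B_ij], C = [C_ij] ∈ M_m(M_n) be positive semidefinite block matrices. Then det₁(A+B+C) + det₁(A) + det₁(B) + det₁(C) ≥ det₁(A+B) + det₁(A+C) + det₁(B+C) in the Löwner order, i.e., the n×n matrix det₁(A+B+C) + det₁(A) + det₁(B) + det₁(C) − det₁(A+B) − det₁(A+C) − det₁(B+C) is positive semidefinite. -/

import Mathlib

open Matrix BigOperators
open scoped ComplexOrder

/-- The first partial determinant of a block matrix `A ∈ M_m(M_n)`:
the `n × n` matrix `[det G_rs]` where `G_rs (i, j) = A (i, r) (j, s)`. -/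
noncomputable def det1 {m n : ℕ} (A : Matrix (Fin m × Fin n) (Fin m × Fin n) ℂ) :
    Matrix (Fin n) (Fin n) ℂ :=
  Matrix.of fun r s => (Matrix.of fun i j => A (i, r) (j, s)).det

/-- A weighted, symmetrised Cauchy-Binet formula. -/
lemma cb_aux {m : ℕ} {κ : Type*} [Fintype κ] (w : κ → ℂ) (a b : κ → Fin m → ℂ) :
    (m.factorial : ℂ) * (Matrix.of fun i j => ∑ k, w k * (a k i * b k j)).det
      = ∑ k : Fin m → κ, (∏ i, w (k i)) *
          ((Matrix.of fun x i => a (k x) i).det * (Matrix.of fun x i => b (k x) i).det) := by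
  classical
  have h1 : (Matrix.of fun i j => ∑ k, w k * (a k i * b k j)).det
      = ∑ k : Fin m → κ, (∏ i, w (k i)) * ((∏ i, a (k i) i) *
          (Matrix.of fun x i => b (k x) i).det) := by
    have e : (Matrix.of fun i j => ∑ k, w k * (a k i * b k j))
        = (fun i => ∑ k, (w k * a k i) • b k) := by
      ext i j
      simp [Finset.sum_apply, mul_assoc]
    rw [e]
    change detRowAlternating.toMultilinearMap (fun i => ∑ k, (w k * a k i) • b k) = _
    rw [MultilinearMap.map_sum]
    refine Finset.sum_congr rfl fun k _ => ?_
    rw [MultilinearMap.map_smul_univ, Finset.prod_mul_distrib, smul_eq_mul, mul_assoc]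
    rfl
  have h2 : ∀ σ : Equiv.Perm (Fin m),
      (Matrix.of fun i j => ∑ k, w k * (a k i * b k j)).det
      = ∑ k : Fin m → κ, (∏ i, w (k i)) * (((Equiv.Perm.sign σ : ℤ) : ℂ) * (∏ i, a (k (σ i)) i) *
          (Matrix.of fun x i => b (k x) i).det) := by
    intro σ
    rw [h1, ← Equiv.sum_comp (Equiv.arrowCongr σ.symm (Equiv.refl κ))]
    refine Finset.sum_congr rfl fun k _ => ?_
    have p1 : (∏ i, w ((Equiv.arrowCongr σ.symm (Equiv.refl κ)) k i)) = ∏ i, w (k i) := by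
      simpa using Equiv.prod_comp σ (fun i => w (k i))
    have p2 : (Matrix.of fun x i => b ((Equiv.arrowCongr σ.symm (Equiv.refl κ)) k x) i).det
        = ((Equiv.Perm.sign σ : ℤ) : ℂ) * (Matrix.of fun x i => b (k x) i).det := by
      rw [← Matrix.det_permute]
      rfl
    rw [p1, p2]
    simp
    ring_nf
    simp
  have h3 : (m.factorial : ℂ) * (Matrix.of fun i j => ∑ k, w k * (a k i * b k j)).det
      = ∑ _σ : Equiv.Perm (Fin m), (Matrix.of fun i j => ∑ k, w k * (a k i * b k j)).det := by
    simp [Fintype.card_perm]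
  rw [h3, Finset.sum_congr rfl (fun σ _ => h2 σ), Finset.sum_comm]
  refine Finset.sum_congr rfl fun k _ => ?_
  rw [← Finset.mul_sum, ← Finset.sum_mul]
  congr 2
  rw [Matrix.det_apply']
  rfl

lemma prop_aux (p0 p1 p2 q0 q1 q2 : Prop) [Decidable p0] [Decidable p1] [Decidable p2]
    [Decidable q0] [Decidable q1] [Decidable q2]
    (e0 : q2 → q1 → p0) (e1 : q2 → q0 → p1) (e2 : q1 → q0 → p2) :
    (0 : ℂ) ≤ 1 + (if p0 then 1 else 0) + (if p1 then 1 else 0) + (if p2 then 1 else 0)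
      - (if q2 then 1 else 0) - (if q1 then 1 else 0) - (if q0 then 1 else 0) := by
  have h : (0 : ℝ) ≤ 1 + (if p0 then 1 else 0) + (if p1 then 1 else 0) + (if p2 then 1 else 0)
      - (if q2 then 1 else 0) - (if q1 then 1 else 0) - (if q0 then 1 else 0) := by
    by_cases h0 : q0 <;> by_cases h1 : q1 <;> by_cases h2 : q2 <;>
      simp only [h0, h1, h2, true_imp_iff, false_imp_iff] at e0 e1 e2 <;>
      simp only [h0, h1, h2, e0, e1, e2, if_true, if_false] <;>
      (try split_ifs) <;> norm_num
  have h' := Complex.zero_le_real.2 h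
  simp only [Complex.ofReal_sub, Complex.ofReal_add, Complex.ofReal_one, Complex.ofReal_zero,
    apply_ite Complex.ofReal] at h'
  exact h'

lemma coef_aux {m : ℕ} (f : Fin m → Fin 3) :
    (0 : ℂ) ≤ 1 + (∏ i, if f i = 0 then 1 else 0) + (∏ i, if f i = 1 then 1 else 0)
      + (∏ i, if f i = 2 then 1 else 0) - (∏ i, if f i ≠ 2 then 1 else 0)
      - (∏ i, if f i ≠ 1 then 1 else 0) - (∏ i, if f i ≠ 0 then 1 else 0) := by
  simp only [Finset.prod_ite_zero, Finset.prod_const_one, Finset.mem_univ, true_imp_iff]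
  have g : ∀ x : Fin 3, (x ≠ 2 → x ≠ 1 → x = 0) ∧ (x ≠ 2 → x ≠ 0 → x = 1)
      ∧ (x ≠ 1 → x ≠ 0 → x = 2) := by decide
  have e0 : (∀ i, f i ≠ 2) → (∀ i, f i ≠ 1) → (∀ i, f i = 0) :=
    fun h h' i => (g _).1 (h i) (h' i)
  have e1 : (∀ i, f i ≠ 2) → (∀ i, f i ≠ 0) → (∀ i, f i = 1) :=
    fun h h' i => (g _).2.1 (h i) (h' i)
  have e2 : (∀ i, f i ≠ 1) → (∀ i, f i ≠ 0) → (∀ i, f i = 2) :=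
    fun h h' i => (g _).2.2 (h i) (h' i)
  exact prop_aux _ _ _ _ _ _ e0 e1 e2

open scoped MatrixOrder in
lemma psd_fac {ι : Type*} [Fintype ι] [DecidableEq ι] {A : Matrix ι ι ℂ} (hA : A.PosSemidef) :
    ∃ X : Matrix ι ι ℂ, A = Xᴴ * X :=
  CStarAlgebra.nonneg_iff_eq_star_mul_self.mp hA.nonneg

theorem det1_superadditive_three {m n : ℕ}
    (A B C : Matrix (Fin m × Fin n) (Fin m × Fin n) ℂ)
    (hA : A.PosSemidef) (hB : B.PosSemidef) (hC : C.PosSemidef) :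
    (det1 (A + B + C) + det1 A + det1 B + det1 C
      - det1 (A + B) - det1 (A + C) - det1 (B + C)).PosSemidef := by
  classical
  obtain ⟨X, hX⟩ : ∃ X : Fin 3 → Matrix (Fin m × Fin n) (Fin m × Fin n) ℂ,
      A = (X 0)ᴴ * X 0 ∧ B = (X 1)ᴴ * X 1 ∧ C = (X 2)ᴴ * X 2 := by
    obtain ⟨a, ha⟩ := psd_fac hA
    obtain ⟨b, hb⟩ := psd_fac hB
    obtain ⟨c, hc⟩ := psd_fac hC
    exact ⟨![a, b, c], ha, hb, hc⟩
  obtain ⟨rfl, rfl, rfl⟩ := hX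
  let v : (Fin m → Fin 3 × (Fin m × Fin n)) → Fin n → ℂ := fun k r =>
    (Matrix.of fun x i => star (X (k x).1 (k x).2 (i, r))).det
  have hfac : (m.factorial : ℂ) ≠ 0 := by exact_mod_cast m.factorial_ne_zero
  have key : ∀ (u : Fin 3 → ℂ) (M : Matrix (Fin m × Fin n) (Fin m × Fin n) ℂ),
      (M = ∑ c, u c • ((X c)ᴴ * X c)) →
      det1 M = (m.factorial : ℂ)⁻¹ • ∑ k : Fin m → Fin 3 × (Fin m × Fin n),
        (∏ i, u (k i).1) • vecMulVec (v k) (star (v k)) := by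
    intro u M hM
    ext r s
    have h := cb_aux (fun k : Fin 3 × (Fin m × Fin n) => u k.1)
      (fun k i => star (X k.1 k.2 (i, r))) (fun k i => X k.1 k.2 (i, s))
    have e : det1 M r s = (Matrix.of fun i j => ∑ k : Fin 3 × (Fin m × Fin n),
        u k.1 * (star (X k.1 k.2 (i, r)) * X k.1 k.2 (j, s))).det := by
      rw [hM]
      unfold det1
      simp only [Matrix.of_apply]
      congr 1
      ext i j
      rw [Matrix.of_apply, Matrix.of_apply, Fintype.sum_prod_type, Matrix.sum_apply]
      simp only [Matrix.smul_apply, Matrix.mul_apply, Matrix.conjTranspose_apply, smul_eq_mul,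
        Finset.mul_sum]
    rw [e, Matrix.smul_apply, smul_eq_mul, eq_inv_mul_iff_mul_eq₀ hfac, h, Matrix.sum_apply]
    refine Finset.sum_congr rfl fun k _ => ?_
    rw [Matrix.smul_apply, smul_eq_mul, vecMulVec_apply]
    congr 2
    simp only [v, Pi.star_apply]
    rw [← Matrix.det_conjTranspose, ← Matrix.det_transpose]
    congr 1
    ext i j
    simp
  rw [key (fun _ => 1) _ (by simp [Fin.sum_univ_three]),
    key (fun c => if c = 0 then 1 else 0) ((X 0)ᴴ * X 0) (by simp [Fin.sum_univ_three]),
    key (fun c => if c = 1 then 1 else 0) ((X 1)ᴴ * X 1) (by simp [Fin.sum_univ_three]),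
    key (fun c => if c = 2 then 1 else 0) ((X 2)ᴴ * X 2) (by simp [Fin.sum_univ_three]),
    key (fun c => if c ≠ 2 then 1 else 0) ((X 0)ᴴ * X 0 + (X 1)ᴴ * X 1)
      (by simp [Fin.sum_univ_three]),
    key (fun c => if c ≠ 1 then 1 else 0) ((X 0)ᴴ * X 0 + (X 2)ᴴ * X 2)
      (by simp [Fin.sum_univ_three]),
    key (fun c => if c ≠ 0 then 1 else 0) ((X 1)ᴴ * X 1 + (X 2)ᴴ * X 2)
      (by simp [Fin.sum_univ_three])]
  simp only [← smul_add, ← smul_sub, ← Finset.sum_add_distrib, ← Finset.sum_sub_distrib,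
    ← add_smul, ← sub_smul, Finset.prod_const_one]
  refine PosSemidef.smul (Matrix.posSemidef_sum _ fun k _ => ?_) ?_
  · exact (posSemidef_vecMulVec_self_star _).smul (coef_aux fun i => (k i).1)
  · rw [inv_nonneg]
    positivity
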